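/- Let L be a countable first-order language, T a consistent L-theory, λ a cardinal with λ < 𝔭, and for each i < λ let Γ_i be a non-principal type over T in finitely many free variables. Then T has a model that omits every Γ_i, i.e., a model M such that for each i < λ no tuple of M satisfies every formula in Γ_i. -/

import Mathlib

open FirstOrder FirstOrder.Language

universe u v

/-- `𝔭`: the least cardinality of a family of meager subsets of `ℝ`
whose union is not meager. -/
noncomputable def pCard : Cardinal :=
  sInf {c : Cardinal | ∃ (ι : Type) (A : ι → Set ℝ),
    (∀ i, IsMeagre (A i)) ∧ ¬ IsMeagre (⋃ i, A i) ∧ c = Cardinal.mk ι}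

/-- A formula `φ(x₀,…,x_{n−1})` is consistent with `T` if some `n`-tuple in some
model of `T` satisfies it. -/
def ConsistentWith {L : FirstOrder.Language.{u, v}} (T : L.Theory) {n : ℕ}
    (φ : L.Formula (Fin n)) : Prop :=
  ∃ (M : Theory.ModelType.{u, v, max u v} T) (v : Fin n → M), φ.Realize v

/-- A set `Γ` of formulas in the free variables `x₀,…,x_{n−1}` is non-principal
over `T` if for every formula `φ` consistent with `T` there is `γ ∈ Γ` such that
`φ ⊓ ∼γ` is consistent with `T`. -/
def NonPrincipal {L : FirstOrder.Language.{u, v}} (T : L.Theory) {n : ℕ}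
    (Γ : Set (L.Formula (Fin n))) : Prop :=
  ∀ φ : L.Formula (Fin n), ConsistentWith T φ →
    ∃ γ ∈ Γ, ConsistentWith T (φ ⊓ γ.not)

/-- One step of the automaton turning a sequence of bits into a descending sequence in a preorder
enumerated by `e`: a bit `0` increments the counter, a bit `1` moves to the element indexed by the
counter if this is a descent, and resets the counter. -/
noncomputable def descentStep {P : Type*} [Preorder P] (e : ℕ → P) (s : P × ℕ) (b : Prop) :
    P × ℕ :=
  open Classical in if b then (if e s.2 ≤ s.1 then e s.2 else s.1, 0) else (s.1, s.2 + 1)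

/-- The state of the automaton `descentStep` after reading the last `N` binary digits of `m`. -/
noncomputable def descentState {P : Type*} [Preorder P] (e : ℕ → P) : ℕ → ℤ → P × ℕ
  | 0, _ => (e 0, 0)
  | N + 1, m => descentStep e (descentState e N (m / 2)) (m % 2 = 1)

section Descent

variable {P : Type*} [Preorder P] (e : ℕ → P)

theorem descentStep_fst_le (s : P × ℕ) (b : Prop) : (descentStep e s b).1 ≤ s.1 := by
  unfold descentStep
  split_ifs with h₁ h₂
  · exact h₂
  · exact le_rfl
  · exact le_rfl

theorem descentState_append_zero (N : ℕ) (m : ℤ) :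
    descentState e (N + 1) (2 * m) =
      ((descentState e N m).1, (descentState e N m).2 + 1) := by
  have h₁ : 2 * m / 2 = m := by omega
  have h₂ : ¬ (2 * m % 2 = 1) := by omega
  simp [descentState, descentStep, h₁]

theorem descentState_append_one (N : ℕ) (m : ℤ) :
    descentState e (N + 1) (2 * m + 1) = descentStep e (descentState e N m) True := by
  have h₁ : (2 * m + 1) / 2 = m := by omega
  have h₂ : (2 * m + 1) % 2 = 1 := by omega
  simp only [descentState, h₁, h₂]

theorem floor_two_pow_succ_mul_div_two (N : ℕ) (y : ℝ) :
    ⌊(2 : ℝ) ^ (N + 1) * y⌋ / 2 = ⌊(2 : ℝ) ^ N * y⌋ := by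
  have h := Int.mul_cast_floor_div_cancel_of_pos (n := 2) (by norm_num) ((2 : ℝ) ^ N * y)
  rw [← h]
  congr 2
  push_cast
  ring

theorem descentState_antitone (y : ℝ) :
    Antitone fun N => (descentState e N ⌊(2 : ℝ) ^ N * y⌋).1 := by
  refine antitone_nat_of_succ_le fun N => ?_
  simp only [descentState, floor_two_pow_succ_mul_div_two]
  exact descentStep_fst_le e _ _

theorem exists_extension_counter_add (N : ℕ) (m : ℤ) (j : ℕ) :
    ∃ (N' : ℕ) (m' : ℤ),
      (∀ y : ℝ, ⌊(2 : ℝ) ^ N' * y⌋ = m' → ⌊(2 : ℝ) ^ N * y⌋ = m) ∧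
      descentState e N' m' = ((descentState e N m).1, (descentState e N m).2 + j) := by
  induction j with
  | zero => exact ⟨N, m, fun _ h => h, rfl⟩
  | succ j ih =>
    obtain ⟨N', m', h, hs⟩ := ih
    refine ⟨N' + 1, 2 * m', fun y hy => h y ?_, ?_⟩
    · rw [← floor_two_pow_succ_mul_div_two, hy]
      omega
    · rw [descentState_append_zero, hs]
      rfl

theorem exists_extension_mem (he : Function.Surjective e) {D : Set P}
    (hD : ∀ p, ∃ q ≤ p, q ∈ D) (N : ℕ) (m : ℤ) :
    ∃ (N' : ℕ) (m' : ℤ),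
      (∀ y : ℝ, ⌊(2 : ℝ) ^ N' * y⌋ = m' → ⌊(2 : ℝ) ^ N * y⌋ = m) ∧
      (descentState e N' m').1 ∈ D := by
  have hone : ∀ (N : ℕ) (m : ℤ) (y : ℝ), ⌊(2 : ℝ) ^ (N + 1) * y⌋ = 2 * m + 1 →
      ⌊(2 : ℝ) ^ N * y⌋ = m := fun N m y hy => by
    rw [← floor_two_pow_succ_mul_div_two, hy]
    omega
  have hreset : (descentState e (N + 1) (2 * m + 1)).2 = 0 := by
    simp [descentState_append_one, descentStep]
  obtain ⟨q, hq, hqD⟩ := hD (descentState e (N + 1) (2 * m + 1)).1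
  obtain ⟨j, rfl⟩ := he q
  obtain ⟨N', m', h, hs⟩ := exists_extension_counter_add e (N + 1) (2 * m + 1) j
  refine ⟨N' + 1, 2 * m' + 1, fun y hy => hone N m y (h y (hone N' m' y hy)), ?_⟩
  rw [hreset, zero_add] at hs
  rw [descentState_append_one, hs]
  simpa [descentStep, hq] using hqD

theorem isMeagre_setOf_descentState_notMem (he : Function.Surjective e) {D : Set P}
    (hD : ∀ p, ∃ q ≤ p, q ∈ D) :
    IsMeagre {y : ℝ | ∀ N, (descentState e N ⌊(2 : ℝ) ^ N * y⌋).1 ∉ D} := by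
  set W : Set ℝ := ⋃ (N : ℕ) (m : ℤ) (_ : (descentState e N m).1 ∈ D),
    {y : ℝ | (m : ℝ) < 2 ^ N * y ∧ 2 ^ N * y < m + 1} with hW
  have hopen : IsOpen W := isOpen_iUnion fun N => isOpen_iUnion fun m => isOpen_iUnion fun _ =>
    (isOpen_lt continuous_const (by fun_prop)).and (isOpen_lt (by fun_prop) continuous_const)
  have hdense : Dense W := by
    refine Metric.dense_iff.2 fun x ε hε => ?_
    obtain ⟨N, hN⟩ := exists_pow_lt_of_lt_one hε (by norm_num : (1 / 2 : ℝ) < 1)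
    obtain ⟨N', m', h, hm⟩ := exists_extension_mem e he hD N ⌊(2 : ℝ) ^ N * x⌋
    have hpos : (0 : ℝ) < 2 ^ N' := by positivity
    set y : ℝ := (m' + 1 / 2) / 2 ^ N' with hy
    have hmul : (2 : ℝ) ^ N' * y = m' + 1 / 2 := by rw [hy]; field_simp
    have hfloor : ⌊(2 : ℝ) ^ N' * y⌋ = m' := by
      rw [hmul, Int.floor_eq_iff]
      constructor <;> linarith
    refine ⟨y, ?_, ?_⟩
    · have hlt := Int.abs_sub_lt_one_of_floor_eq_floor (h y hfloor)
      rw [← mul_sub, abs_mul, abs_of_pos (by positivity : (0 : ℝ) < 2 ^ N)] at hlt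
      rw [Metric.mem_ball, Real.dist_eq]
      refine lt_trans ?_ hN
      rw [one_div, inv_pow, ← one_div, lt_div_iff₀ (by positivity)]
      linarith
    · simp only [hW, Set.mem_iUnion]
      exact ⟨N', m', hm, by constructor <;> linarith⟩
  refine Filter.mem_of_superset (residual_of_dense_open hopen hdense) fun y hy => ?_
  simp only [hW, Set.mem_iUnion] at hy
  obtain ⟨N, m, hm, h₁, h₂⟩ := hy
  have hfloor : ⌊(2 : ℝ) ^ N * y⌋ = m := Int.floor_eq_iff.2 ⟨h₁.le, h₂⟩
  simp only [Set.mem_compl_iff, Set.mem_ofPred_eq, not_forall, not_not]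
  exact ⟨N, by rwa [hfloor]⟩

end Descent

theorem isMeagre_iUnion_of_mk_lt_pCard {ι : Type} (hι : Cardinal.mk ι < pCard)
    {A : ι → Set ℝ} (hA : ∀ i, IsMeagre (A i)) : IsMeagre (⋃ i, A i) := by
  by_contra h
  exact notMem_of_lt_csInf' hι ⟨ι, A, hA, h, rfl⟩

/-- In a countable preorder there is a descending sequence meeting fewer than `𝔭` countable families
of dense sets. -/
theorem exists_antitone_meeting_dense {P : Type*} [Preorder P] [Countable P] [Nonempty P]
    {ι : Type} (hι : Cardinal.mk ι < pCard) {κ : ι → Type*} [∀ i, Countable (κ i)]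
    {D : (i : ι) → κ i → Set P} (hD : ∀ i k p, ∃ q ≤ p, q ∈ D i k)
    {κ' : Type*} [Countable κ'] {E : κ' → Set P} (hE : ∀ k p, ∃ q ≤ p, q ∈ E k) :
    ∃ f : ℕ → P, Antitone f ∧ (∀ i k, ∃ N, f N ∈ D i k) ∧ ∀ k, ∃ N, f N ∈ E k := by
  obtain ⟨e, he⟩ := exists_surjective_nat P
  have hDm := isMeagre_iUnion_of_mk_lt_pCard hι fun i => isMeagre_iUnion fun k =>
    isMeagre_setOf_descentState_notMem e he (hD i k)
  have hEm := isMeagre_iUnion fun k => isMeagre_setOf_descentState_notMem e he (hE k)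
  obtain ⟨y, hyD, hyE⟩ := (dense_of_mem_residual (Filter.inter_mem hDm hEm)).nonempty
  simp only [Set.mem_compl_iff, Set.mem_iUnion, Set.mem_ofPred_eq, not_exists, not_forall,
    not_not] at hyD hyE
  exact ⟨_, descentState_antitone e y, hyD, hyE⟩

theorem FirstOrder.Language.Formula.realize_congr_of_freeVarFinset
    {L : FirstOrder.Language.{u, v}} {α M : Type*} [DecidableEq α] [L.Structure M]
    (φ : L.Formula α) {v w : α → M} (h : ∀ a ∈ φ.freeVarFinset, v a = w a) :
    φ.Realize v ↔ φ.Realize w :=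
  (BoundedFormula.realize_restrictFreeVar (φ := φ) (f := fun a => (a : α)) (v := v) v
    fun _ => rfl).symm.trans
  (BoundedFormula.realize_restrictFreeVar (φ := φ) (f := fun a => (a : α)) (v := v) w
    fun a => h a a.2)

/-- The formulas in the variables `x₀, x₁, …` which are consistent with `T`. -/
def ConsistentFormula {L : FirstOrder.Language.{u, v}} (T : L.Theory) : Type max u v :=
  {φ : L.Formula ℕ // ∃ (M : Theory.ModelType.{u, v, max u v} T) (v : ℕ → M), φ.Realize v}

namespace ConsistentFormula

variable {L : FirstOrder.Language.{u, v}} {T : L.Theory}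

/-- `p` forces `φ` if `φ` is a consequence of `p` modulo `T`. -/
def Forces (p : ConsistentFormula T) (φ : L.Formula ℕ) : Prop :=
  ∀ (M : Theory.ModelType.{u, v, max u v} T) (v : ℕ → M), p.1.Realize v → φ.Realize v

instance : Preorder (ConsistentFormula T) where
  le p q := p.Forces q.1
  le_refl _ _ _ h := h
  le_trans _ _ _ h₁ h₂ M v h := h₂ M v (h₁ M v h)

theorem exists_le_forces (p : ConsistentFormula T) (φ : L.Formula ℕ)
    (M : Theory.ModelType.{u, v, max u v} T) (v : ℕ → M) (hp : p.1.Realize v)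
    (hφ : φ.Realize v) : ∃ q ≤ p, q.Forces φ :=
  ⟨⟨p.1 ⊓ φ, M, v, Formula.realize_inf.2 ⟨hp, hφ⟩⟩, fun _ _ h => (Formula.realize_inf.1 h).1,
    fun _ _ h => (Formula.realize_inf.1 h).2⟩

theorem exists_le_forces_witness (χ : L.Formula (ℕ ⊕ Unit)) (p : ConsistentFormula T) :
    ∃ q ≤ p, q ∈ {q : ConsistentFormula T | q.Forces (χ.iExs Unit).not ∨
      ∃ k : ℕ, q.Forces (χ.relabel (Sum.elim id fun _ => k))} := by
  classical
  obtain ⟨M, v, hv⟩ := p.2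
  by_cases h : (χ.iExs Unit).Realize v
  · obtain ⟨a, ha⟩ := Formula.realize_iExs.1 h
    obtain ⟨k, hk⟩ := Infinite.exists_notMem_finset
      (p.1.freeVarFinset ∪ χ.freeVarFinset.toLeft)
    simp only [Finset.mem_union, Finset.mem_toLeft, not_or] at hk
    have hp : p.1.Realize (Function.update v k (a ())) := by
      refine (Formula.realize_congr_of_freeVarFinset _ fun j hj => ?_).2 hv
      exact Function.update_of_ne (ne_of_mem_of_not_mem hj hk.1) _ _
    have hχ : (χ.relabel (Sum.elim id fun _ => k)).Realize (Function.update v k (a ())) := by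
      rw [Formula.realize_relabel]
      refine (Formula.realize_congr_of_freeVarFinset _ fun j hj => ?_).2 ha
      rcases j with j | j
      · exact Function.update_of_ne (fun hjk : j = k => hk.2 (hjk ▸ hj)) _ _
      · simp
    obtain ⟨q, hq, hqf⟩ := p.exists_le_forces _ M _ hp hχ
    exact ⟨q, hq, Or.inr ⟨k, hqf⟩⟩
  · obtain ⟨q, hq, hqf⟩ := p.exists_le_forces (χ.iExs Unit).not M v hv
      (Formula.realize_not.2 h)
    exact ⟨q, hq, Or.inl hqf⟩

theorem exists_le_forces_not_mem_type {n : ℕ} {Γ : Set (L.Formula (Fin n))}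
    (hΓ : NonPrincipal T Γ) (a : Fin n → ℕ) (p : ConsistentFormula T) :
    ∃ q ≤ p, q ∈ {q : ConsistentFormula T | ∃ γ ∈ Γ, q.Forces (γ.relabel a).not} := by
  classical
  let S : Finset ℕ := p.1.freeVarFinset ∪ Finset.univ.image a
  have haS : ∀ j, a j ∈ S := fun j => by simp [S]
  let ψ : L.Formula (Fin n ⊕ S) :=
    p.1.restrictFreeVar fun k => Sum.inr ⟨k, Finset.mem_union_left _ k.2⟩
  let φ : L.Formula (Fin n) := Formula.iExs S (ψ ⊓ Formula.iInf fun j : Fin n =>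
    Term.equal (Term.var (Sum.inl j)) (Term.var (Sum.inr ⟨a j, haS j⟩)))
  have hφ : ∀ (M : Theory.ModelType.{u, v, max u v} T) (w : Fin n → M),
      φ.Realize w ↔ ∃ v : ℕ → M, p.1.Realize v ∧ w = v ∘ a := by
    intro M w
    have hψ : ∀ (s : S → M) (v : ℕ → M), (∀ k, s k = v k) →
        (ψ.Realize (Sum.elim w s) ↔ p.1.Realize v) := fun s v h =>
      BoundedFormula.realize_restrictFreeVar v fun k => h _
    simp only [φ, Formula.realize_iExs, Formula.realize_inf, Formula.realize_iInf,
      Formula.realize_equal, Term.realize_var, Sum.elim_inl, Sum.elim_inr]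
    constructor
    · rintro ⟨s, hs, hw⟩
      let v : ℕ → M := fun k => if hk : k ∈ S then s ⟨k, hk⟩ else Classical.arbitrary M
      refine ⟨v, (hψ s v fun k => by simp [v]).1 hs, funext fun j => ?_⟩
      simp [v, haS, hw]
    · rintro ⟨v, hv, rfl⟩
      exact ⟨fun k => v k, (hψ _ v fun _ => rfl).2 hv, fun _ => rfl⟩
  obtain ⟨M, v, hv⟩ := p.2
  obtain ⟨γ, hγ, M', w, hw⟩ := hΓ φ ⟨M, v ∘ a, (hφ M _).2 ⟨v, hv, rfl⟩⟩
  obtain ⟨hwφ, hwγ⟩ := Formula.realize_inf.1 hw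
  obtain ⟨v', hv', rfl⟩ := (hφ M' w).1 hwφ
  obtain ⟨q, hq, hqf⟩ := p.exists_le_forces (γ.relabel a).not M' v' hv' (by
    rw [Formula.realize_not, Formula.realize_relabel]
    exact Formula.realize_not.1 hwγ)
  exact ⟨q, hq, γ, hγ, hqf⟩

/-- A descending sequence of consistent formulas is realized in a model of `T`. -/
theorem exists_realize_of_antitone {f : ℕ → ConsistentFormula T} (hf : Antitone f) :
    ∃ (M : Theory.ModelType.{u, v, max u v} T) (v : ℕ → M), ∀ N, (f N).1.Realize v := by
  let U : ℕ → L[[ℕ]].Theory := fun N => (L.lhomWithConstants ℕ).onTheory T ∪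
    (fun k => Formula.equivSentence (f k).1) '' Set.Iic N
  have hU : Monotone U := fun _ _ h =>
    Set.union_subset_union_right _ (Set.image_mono (Set.Iic_subset_Iic.2 h))
  have hsat : Theory.IsSatisfiable (⋃ N, U N) := by
    refine (Theory.isSatisfiable_directed_union_iff hU.directed_le).2 fun N => ?_
    obtain ⟨M, v, hv⟩ := (f N).2
    let := constantsOn.structure v
    have hM : M ⊨ U N := by
      refine Theory.model_union_iff.2 ⟨(LHom.onTheory_model _ T).2 M.is_model, ?_⟩
      refine (Theory.model_iff _).2 ?_
      rintro _ ⟨k, hk, rfl⟩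
      exact (Formula.realize_equivSentence M _).2 (hf hk M v hv)
    exact Theory.Model.isSatisfiable M
  obtain ⟨M⟩ := hsat
  have hT : (L.lhomWithConstants ℕ).onTheory T ⊆ ⋃ N, U N :=
    Set.subset_iUnion_of_subset 0 Set.subset_union_left
  refine ⟨(M.subtheoryModel hT).reduct (L.lhomWithConstants ℕ), fun k => (L.con k : M),
    fun N => ?_⟩
  exact (@Formula.realize_equivSentence _
    ((M.subtheoryModel hT).reduct (L.lhomWithConstants ℕ)) _ _ M.struc
    (LHom.isExpansionOn_reduct (L.lhomWithConstants ℕ) M) (f N).1).1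
    (Theory.realize_sentence_of_mem (M := M) (⋃ N, U N)
      (Set.mem_iUnion.2 ⟨N, Or.inr ⟨N, Set.mem_Iic.2 le_rfl, rfl⟩⟩))

end ConsistentFormula

/-- A valuation `v : ℕ → M` whose range contains witnesses for all existential formulas has
an elementary substructure of `M` as its range. -/
theorem exists_elementarySubstructure_of_witnesses {L : FirstOrder.Language.{u, v}} {M : Type*}
    [L.Structure M] (v : ℕ → M)
    (hv : ∀ χ : L.Formula (ℕ ⊕ Unit), (χ.iExs Unit).Realize v →
      ∃ k : ℕ, (χ.relabel (Sum.elim id fun _ => k)).Realize v) :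
    ∃ S : L.ElementarySubstructure M, (S : Set M) = Set.range v := by
  have hv' : ∀ (χ : L.Formula (ℕ ⊕ Unit)) (b : M), χ.Realize (Sum.elim v fun _ => b) →
      ∃ k, χ.Realize (Sum.elim v fun _ => v k) := fun χ b hb => by
    obtain ⟨k, hk⟩ := hv χ (Formula.realize_iExs.2 ⟨_, hb⟩)
    refine ⟨k, ?_⟩
    rw [Formula.realize_relabel] at hk
    convert hk using 1
    ext (_ | _) <;> rfl
  let S : L.Substructure M :=
    { carrier := Set.range v
      fun_mem := fun {n} g x hx => by
        choose a ha using hx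
        obtain ⟨k, hk⟩ := hv' (Term.equal (Term.var (Sum.inr ()))
          (Term.func g fun i => Term.var (Sum.inl (a i)))) (Structure.funMap g x)
          (by simp [Formula.realize_equal, ha])
        refine ⟨k, ?_⟩
        simpa [Formula.realize_equal, ha] using hk }
  refine ⟨⟨S, S.isElementary_of_exists fun n φ x b hb => ?_⟩, rfl⟩
  choose a ha using fun i => (x i).2
  let g : Empty ⊕ Fin (n + 1) → ℕ ⊕ Unit :=
    Sum.elim Empty.elim (Fin.snoc (fun i => Sum.inl (a i)) (Sum.inr ()))
  have hg : ∀ c : M, (φ.toFormula.relabel g).Realize (Sum.elim v fun _ => c) ↔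
      φ.Realize default (Fin.snoc ((↑) ∘ x) c : _ → M) := fun c => by
    rw [Formula.realize_relabel, BoundedFormula.realize_toFormula]
    refine iff_of_eq (congrArg₂ _ (Subsingleton.elim _ _) (funext fun i => ?_))
    refine Fin.lastCases ?_ (fun i => ?_) i
    · simp [g]
    · simp [g, ha]
  obtain ⟨k, hk⟩ := hv' _ b ((hg b).2 hb)
  exact ⟨⟨v k, k, rfl⟩, (hg _).1 hk⟩

/-- Omitting types theorem: a consistent theory in a countable language has a model
omitting any family of fewer than `𝔭` non-principal types (each in finitely many
free variables). -/
theorem omitting_types_below_p {L : FirstOrder.Language.{u, v}}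
    (hL : L.card ≤ Cardinal.aleph0)
    (T : L.Theory) (hT : T.IsSatisfiable)
    (ι : Type) (hι : Cardinal.mk ι < pCard)
    (n : ι → ℕ) (Γ : (i : ι) → Set (L.Formula (Fin (n i))))
    (hΓ : ∀ i, NonPrincipal T (Γ i)) :
    ∃ M : Theory.ModelType.{u, v, max u v} T,
      ∀ i, ¬ ∃ v : Fin (n i) → M, ∀ γ ∈ Γ i, γ.Realize v := by
  have : Countable L.Symbols := Cardinal.mk_le_aleph0_iff.1 hL
  have : Countable (ConsistentFormula T) := inferInstanceAs (Countable (Subtype _))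
  obtain ⟨M₀⟩ := hT
  have : Nonempty (ConsistentFormula T) :=
    ⟨⟨⊤, M₀, fun _ => Classical.arbitrary M₀, Formula.realize_top.2 trivial⟩⟩
  obtain ⟨f, hf, hfΓ, hfχ⟩ := exists_antitone_meeting_dense hι
    (fun i => ConsistentFormula.exists_le_forces_not_mem_type (hΓ i))
    (ConsistentFormula.exists_le_forces_witness (T := T))
  obtain ⟨M, v, hv⟩ := ConsistentFormula.exists_realize_of_antitone hf
  obtain ⟨S, hS⟩ := exists_elementarySubstructure_of_witnesses v fun χ hχ => by
    obtain ⟨N, hN | ⟨k, hk⟩⟩ := hfχ χ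
    · exact absurd hχ (Formula.realize_not.1 (hN M v (hv N)))
    · exact ⟨k, hk M v (hv N)⟩
  have : S ⊨ T := S.theory_model
  have : Nonempty S := ⟨⟨v 0, by rw [← SetLike.mem_coe, hS]; exact ⟨0, rfl⟩⟩⟩
  refine ⟨Theory.ModelType.of T S, fun i ⟨w, hw⟩ => ?_⟩
  have hrange : ∀ j, ∃ k, v k = S.subtype (w j) := fun j => by
    have := (w j).2
    rwa [← SetLike.mem_coe, hS] at this
  choose a ha using hrange
  obtain ⟨N, γ, hγ, hN⟩ := hfΓ i a
  have h := Formula.realize_not.1 (hN M v (hv N))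
  rw [Formula.realize_relabel, show v ∘ a = S.subtype ∘ w from funext ha] at h
  exact h ((S.subtype.map_formula γ w).2 (hw γ hγ))
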